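/- Normalization for the simply typed λ-calculus: every term Γ ⊢ t : A of the simply typed λ-calculus is βη-equal to a term in η-long β-normal form. -/

import Mathlib

/-- Simple types: freely generated by a base type and function types. -/
inductive Ty : Type
  | base : Ty
  | arrow : Ty → Ty → Ty

/-- Intrinsically-typed de Bruijn terms of the simply typed λ-calculus
(α-equivalence classes of named terms). -/
inductive Tm : List Ty → Ty → Type
  | var : {Γ : List Ty} → (i : Fin Γ.length) → Tm Γ (Γ.get i)
  | app : {Γ : List Ty} → {A B : Ty} → Tm Γ (Ty.arrow A B) → Tm Γ A → Tm Γ B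
  | lam : {Γ : List Ty} → {A B : Ty} → Tm (A :: Γ) B → Tm Γ (Ty.arrow A B)

/-- Variable renamings `Δ → Γ`: a sort-preserving choice of a variable of `Δ` for each
variable of `Γ`. -/
def Ren (Δ Γ : List Ty) : Type := (i : Fin Γ.length) → { j : Fin Δ.length // Δ.get j = Γ.get i }

/-- Lift a renaming under a binder. -/
def Ren.lift {Δ Γ : List Ty} (ρ : Ren Δ Γ) (A : Ty) : Ren (A :: Δ) (A :: Γ) := fun i =>
  Fin.cases ⟨⟨0, by simp⟩, rfl⟩ (fun i' => ⟨(ρ i').1.succ, (ρ i').2⟩) i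

/-- The weakening renaming `Γ → A :: Γ`. -/
def Ren.up (Δ : List Ty) (A : Ty) : Ren (A :: Δ) Δ := fun i => ⟨i.succ, rfl⟩

/-- Renaming of variables in a term. -/
def Tm.rename : {Γ Δ : List Ty} → {A : Ty} → Tm Γ A → Ren Δ Γ → Tm Δ A
  | _, _, _, Tm.var i, ρ => (ρ i).2 ▸ Tm.var (ρ i).1
  | _, _, _, Tm.app f a, ρ => Tm.app (f.rename ρ) (a.rename ρ)
  | _, _, _, Tm.lam t, ρ => Tm.lam (t.rename (ρ.lift _))

/-- Simultaneous substitutions `Δ → Γ`. -/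
def Sb (Δ Γ : List Ty) : Type := (i : Fin Γ.length) → Tm Δ (Γ.get i)

/-- Lift a substitution under a binder. -/
def Sb.lift {Δ Γ : List Ty} (σ : Sb Δ Γ) (A : Ty) : Sb (A :: Δ) (A :: Γ) := fun i =>
  Fin.cases (Tm.var ⟨0, by simp⟩) (fun i' => (σ i').rename (Ren.up Δ A)) i

/-- Capture-avoiding simultaneous substitution. -/
def Tm.subst : {Γ Δ : List Ty} → {A : Ty} → Tm Γ A → Sb Δ Γ → Tm Δ A
  | _, _, _, Tm.var i, σ => σ i
  | _, _, _, Tm.app f a, σ => Tm.app (f.subst σ) (a.subst σ)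
  | _, _, _, Tm.lam t, σ => Tm.lam (t.subst (σ.lift _))

/-- The substitution replacing the last-bound variable by `u` and leaving the others alone. -/
def Sb.single {Γ : List Ty} {A : Ty} (u : Tm Γ A) : Sb Γ (A :: Γ) := fun i =>
  Fin.cases u (fun i' => Tm.var i') i
/-- βη-equality of simply typed λ-terms: the congruence generated by the β- and η-rules. -/
inductive BetaEta : {Γ : List Ty} → {A : Ty} → Tm Γ A → Tm Γ A → Prop
  | refl {Γ : List Ty} {A : Ty} {t : Tm Γ A} : BetaEta t t
  | symm {Γ : List Ty} {A : Ty} {t u : Tm Γ A} : BetaEta t u → BetaEta u t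
  | trans {Γ : List Ty} {A : Ty} {t u v : Tm Γ A} : BetaEta t u → BetaEta u v → BetaEta t v
  | congApp {Γ : List Ty} {A B : Ty} {f f' : Tm Γ (Ty.arrow A B)} {a a' : Tm Γ A} :
      BetaEta f f' → BetaEta a a' → BetaEta (Tm.app f a) (Tm.app f' a')
  | congLam {Γ : List Ty} {A B : Ty} {t t' : Tm (A :: Γ) B} :
      BetaEta t t' → BetaEta (Tm.lam t) (Tm.lam t')
  | beta {Γ : List Ty} {A B : Ty} (t : Tm (A :: Γ) B) (u : Tm Γ A) :
      BetaEta (Tm.app (Tm.lam t) u) (t.subst (Sb.single u))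
  | eta {Γ : List Ty} {A B : Ty} (t : Tm Γ (Ty.arrow A B)) :
      BetaEta t (Tm.lam (Tm.app (t.rename (Ren.up Γ A)) (Tm.var ⟨0, by simp⟩)))

/-- βη-equality is an equivalence relation on each term set. -/
def beSetoid (Γ : List Ty) (A : Ty) : Setoid (Tm Γ A) :=
  ⟨BetaEta, ⟨fun _ => BetaEta.refl, BetaEta.symm, BetaEta.trans⟩⟩
mutual
  /-- η-long β-normal forms. -/
  inductive NormalForm : {Γ : List Ty} → {A : Ty} → Tm Γ A → Prop
    | ofNeutral {Γ : List Ty} {t : Tm Γ Ty.base} : NeutralForm t → NormalForm t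
    | lam {Γ : List Ty} {A B : Ty} {t : Tm (A :: Γ) B} : NormalForm t → NormalForm (Tm.lam t)
  /-- Neutral forms. -/
  inductive NeutralForm : {Γ : List Ty} → {A : Ty} → Tm Γ A → Prop
    | var {Γ : List Ty} (i : Fin Γ.length) : NeutralForm (Tm.var i)
    | app {Γ : List Ty} {A B : Ty} {f : Tm Γ (Ty.arrow A B)} {a : Tm Γ A} :
        NeutralForm f → NormalForm a → NeutralForm (Tm.app f a)
end

/-- Transport along an equality of types commutes with renaming. -/
theorem Tm.rename_cast {Γ Δ : List Ty} {A B : Ty} (h : A = B) (t : Tm Γ A) (ρ : Ren Δ Γ) :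
    (h ▸ t : Tm Γ B).rename ρ = h ▸ t.rename ρ := by
  subst h; rfl

/-- Transport along an equality of types commutes with substitution. -/
theorem Tm.subst_cast {Γ Δ : List Ty} {A B : Ty} (h : A = B) (t : Tm Γ A) (σ : Sb Δ Γ) :
    (h ▸ t : Tm Γ B).subst σ = h ▸ t.subst σ := by
  subst h; rfl

theorem Tm.cast_cast {Γ : List Ty} {A B C : Ty} (h : A = B) (h' : B = C) (t : Tm Γ A) :
    (h' ▸ (h ▸ t : Tm Γ B) : Tm Γ C) = (h.trans h') ▸ t := by
  subst h; rfl

/-- Composition of renamings. -/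
def Ren.comp {Γ Δ Θ : List Ty} (ρ : Ren Θ Δ) (ρ' : Ren Δ Γ) : Ren Θ Γ := fun i =>
  ⟨(ρ (ρ' i).1).1, (ρ (ρ' i).1).2.trans (ρ' i).2⟩

/-- The identity renaming. -/
def Ren.id (Γ : List Ty) : Ren Γ Γ := fun i => ⟨i, rfl⟩

theorem Ren.lift_id (Γ : List Ty) (A : Ty) : (Ren.id Γ).lift A = Ren.id (A :: Γ) := by
  funext i
  refine Fin.cases ?_ (fun i => ?_) i <;> rfl

theorem Ren.lift_comp {Γ Δ Θ : List Ty} (ρ : Ren Θ Δ) (ρ' : Ren Δ Γ) (A : Ty) :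
    (ρ.lift A).comp (ρ'.lift A) = (ρ.comp ρ').lift A := by
  funext i
  refine Fin.cases ?_ (fun i => ?_) i <;> rfl

theorem Tm.rename_id {Γ : List Ty} {A : Ty} (t : Tm Γ A) : t.rename (Ren.id Γ) = t := by
  induction t with
  | var i => rfl
  | app f a ihf iha => simp only [Tm.rename, ihf, iha]
  | lam t ih => simp only [Tm.rename, Ren.lift_id, ih]

theorem Tm.rename_rename {Γ Δ Θ : List Ty} {A : Ty} (t : Tm Γ A) (ρ' : Ren Δ Γ) (ρ : Ren Θ Δ) :
    (t.rename ρ').rename ρ = t.rename (ρ.comp ρ') := by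
  induction t generalizing Δ Θ with
  | var i => simp only [Tm.rename, Tm.rename_cast, Tm.cast_cast, Ren.comp]
  | app f a ihf iha => simp only [Tm.rename, ihf, iha]
  | lam t ih => simp only [Tm.rename, ih, Ren.lift_comp]

theorem Tm.rename_up_rename_lift {Γ Δ : List Ty} {A : Ty} (t : Tm Γ A) (ρ : Ren Δ Γ) (B : Ty) :
    (t.rename (Ren.up Γ B)).rename (ρ.lift B) = (t.rename ρ).rename (Ren.up Δ B) := by
  rw [Tm.rename_rename, Tm.rename_rename]; rfl

/-- Precomposition of a substitution with a renaming. -/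
def Sb.compRen {Γ Δ Θ : List Ty} (σ : Sb Θ Δ) (ρ : Ren Δ Γ) : Sb Θ Γ := fun i =>
  (ρ i).2 ▸ σ (ρ i).1

/-- Renaming of the terms of a substitution. -/
def Sb.rename {Γ Δ Θ : List Ty} (σ : Sb Δ Γ) (ρ : Ren Θ Δ) : Sb Θ Γ := fun i =>
  (σ i).rename ρ

/-- Composition of substitutions. -/
def Sb.comp {Γ Δ Θ : List Ty} (τ : Sb Θ Δ) (σ : Sb Δ Γ) : Sb Θ Γ := fun i =>
  (σ i).subst τ

/-- The identity substitution. -/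
def Sb.id (Γ : List Ty) : Sb Γ Γ := fun i => Tm.var i

/-- Extension of a substitution by a term for the last-bound variable. -/
def Sb.cons {Γ Δ : List Ty} {A : Ty} (u : Tm Δ A) (σ : Sb Δ Γ) : Sb Δ (A :: Γ) := fun i =>
  Fin.cases u (fun i' => σ i') i

theorem Sb.lift_id (Γ : List Ty) (A : Ty) : (Sb.id Γ).lift A = Sb.id (A :: Γ) := by
  funext i
  refine Fin.cases ?_ (fun i => ?_) i <;> rfl

theorem Sb.lift_compRen {Γ Δ Θ : List Ty} (σ : Sb Θ Δ) (ρ : Ren Δ Γ) (A : Ty) :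
    (σ.lift A).compRen (ρ.lift A) = (σ.compRen ρ).lift A := by
  funext i
  refine Fin.cases ?_ (fun i => ?_) i
  · rfl
  · exact (Tm.rename_cast (ρ i).2 (σ (ρ i).1) (Ren.up Θ A)).symm

theorem Sb.lift_rename {Γ Δ Θ : List Ty} (σ : Sb Δ Γ) (ρ : Ren Θ Δ) (A : Ty) :
    (σ.lift A).rename (ρ.lift A) = (σ.rename ρ).lift A := by
  funext i
  refine Fin.cases ?_ (fun i => ?_) i
  · rfl
  · exact Tm.rename_up_rename_lift (σ i) ρ A

theorem Tm.subst_id {Γ : List Ty} {A : Ty} (t : Tm Γ A) : t.subst (Sb.id Γ) = t := by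
  induction t with
  | var i => rfl
  | app f a ihf iha => simp only [Tm.subst, ihf, iha]
  | lam t ih => simp only [Tm.subst, Sb.lift_id, ih]

theorem Tm.subst_rename_left {Γ Δ Θ : List Ty} {A : Ty} (t : Tm Γ A) (ρ : Ren Δ Γ)
    (σ : Sb Θ Δ) : (t.rename ρ).subst σ = t.subst (σ.compRen ρ) := by
  induction t generalizing Δ Θ with
  | var i => simp only [Tm.rename, Tm.subst, Tm.subst_cast, Sb.compRen]
  | app f a ihf iha => simp only [Tm.rename, Tm.subst, ihf, iha]
  | lam t ih => simp only [Tm.rename, Tm.subst, ih, Sb.lift_compRen]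

theorem Tm.rename_subst {Γ Δ Θ : List Ty} {A : Ty} (t : Tm Γ A) (σ : Sb Δ Γ)
    (ρ : Ren Θ Δ) : (t.subst σ).rename ρ = t.subst (σ.rename ρ) := by
  induction t generalizing Δ Θ with
  | var i => rfl
  | app f a ihf iha => simp only [Tm.rename, Tm.subst, ihf, iha]
  | lam t ih => simp only [Tm.rename, Tm.subst, ih, Sb.lift_rename]

theorem Sb.lift_comp {Γ Δ Θ : List Ty} (τ : Sb Θ Δ) (σ : Sb Δ Γ) (A : Ty) :
    (τ.lift A).comp (σ.lift A) = (τ.comp σ).lift A := by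
  funext i
  refine Fin.cases ?_ (fun i => ?_) i
  · rfl
  · exact (Tm.subst_rename_left (σ i) _ _).trans (Tm.rename_subst (σ i) τ _).symm

theorem Tm.subst_subst {Γ Δ Θ : List Ty} {A : Ty} (t : Tm Γ A) (σ : Sb Δ Γ)
    (τ : Sb Θ Δ) : (t.subst σ).subst τ = t.subst (τ.comp σ) := by
  induction t generalizing Δ Θ with
  | var i => rfl
  | app f a ihf iha => simp only [Tm.subst, ihf, iha]
  | lam t ih => simp only [Tm.subst, ih, Sb.lift_comp]

theorem Sb.single_comp_lift {Γ Δ : List Ty} {A : Ty} (u : Tm Δ A) (σ : Sb Δ Γ) :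
    (Sb.single u).comp (σ.lift A) = Sb.cons u σ := by
  funext i
  refine Fin.cases ?_ (fun i => ?_) i
  · rfl
  · exact (Tm.subst_rename_left (σ i) _ _).trans (Tm.subst_id (σ i))

theorem Tm.rename_subst_single {Γ Δ : List Ty} {A B : Ty} (t : Tm (A :: Γ) B) (u : Tm Γ A)
    (ρ : Ren Δ Γ) :
    (t.subst (Sb.single u)).rename ρ =
      (t.rename (ρ.lift A)).subst (Sb.single (u.rename ρ)) := by
  rw [Tm.rename_subst, Tm.subst_rename_left]
  congr 1
  funext i
  refine Fin.cases ?_ (fun i => ?_) i <;> rfl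

theorem BetaEta.rename {Γ : List Ty} {A : Ty} {t u : Tm Γ A} (h : BetaEta t u) :
    ∀ {Δ : List Ty} (ρ : Ren Δ Γ), BetaEta (t.rename ρ) (u.rename ρ) := by
  induction h with
  | refl => exact fun _ => .refl
  | symm _ ih => exact fun ρ => (ih ρ).symm
  | trans _ _ ih₁ ih₂ => exact fun ρ => (ih₁ ρ).trans (ih₂ ρ)
  | congApp _ _ ih₁ ih₂ => exact fun ρ => .congApp (ih₁ ρ) (ih₂ ρ)
  | congLam _ ih => exact fun ρ => .congLam (ih (ρ.lift _))
  | beta t u =>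
    intro Δ ρ
    rw [Tm.rename_subst_single]
    exact .beta _ _
  | @eta Γ A B t =>
    intro Δ ρ
    have h := BetaEta.eta (t.rename ρ)
    rw [← Tm.rename_up_rename_lift] at h
    exact h

theorem NeutralForm.cast {Γ : List Ty} {A B : Ty} (h : A = B) {t : Tm Γ A}
    (ht : NeutralForm t) : NeutralForm (h ▸ t : Tm Γ B) := by
  subst h; exact ht

mutual

theorem NormalForm.rename {Γ Δ : List Ty} {A : Ty} {t : Tm Γ A} (ρ : Ren Δ Γ) :
    NormalForm t → NormalForm (t.rename ρ)
  | .ofNeutral h => .ofNeutral (h.rename ρ)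
  | .lam h => .lam (h.rename (ρ.lift _))

theorem NeutralForm.rename {Γ Δ : List Ty} {A : Ty} {t : Tm Γ A} (ρ : Ren Δ Γ) :
    NeutralForm t → NeutralForm (t.rename ρ)
  | .var i => (NeutralForm.var (ρ i).1).cast (ρ i).2
  | .app hf ha => .app (hf.rename ρ) (ha.rename ρ)

end

/-- The Kripke logical predicate: a term of base type is reducible if it has a normal form, and
a term of function type is reducible if each of its renamings preserves reducibility. -/
def Reducible : (A : Ty) → {Γ : List Ty} → Tm Γ A → Prop
  | .base, _, t => ∃ n, NormalForm n ∧ BetaEta t n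
  | .arrow A B, Γ, t => ∀ (Δ : List Ty) (ρ : Ren Δ Γ) (a : Tm Δ A),
      Reducible A a → Reducible B (Tm.app (t.rename ρ) a)

theorem Reducible.of_betaEta {A : Ty} {Γ : List Ty} {t u : Tm Γ A} (h : BetaEta t u)
    (hu : Reducible A u) : Reducible A t := by
  induction A generalizing Γ with
  | base =>
    obtain ⟨n, hn, hun⟩ := hu
    exact ⟨n, hn, h.trans hun⟩
  | arrow A B _ ihB =>
    exact fun Δ ρ a ha => ihB (.congApp (h.rename ρ) .refl) (hu Δ ρ a ha)

theorem Reducible.rename {A : Ty} {Γ Δ : List Ty} {t : Tm Γ A} (ht : Reducible A t)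
    (ρ : Ren Δ Γ) : Reducible A (t.rename ρ) := by
  cases A with
  | base =>
    obtain ⟨n, hn, htn⟩ := ht
    exact ⟨n.rename ρ, hn.rename ρ, htn.rename ρ⟩
  | arrow A B =>
    intro Θ ρ' a ha
    rw [Tm.rename_rename]
    exact ht Θ _ a ha

/-- Reducible terms have normal forms, and neutral terms are reducible. -/
theorem Reducible.reify_reflect (A : Ty) :
    (∀ {Γ : List Ty} {t : Tm Γ A}, Reducible A t → ∃ n, NormalForm n ∧ BetaEta t n) ∧
    (∀ {Γ : List Ty} {t : Tm Γ A}, NeutralForm t → Reducible A t) := by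
  induction A with
  | base => exact ⟨fun h => h, fun h => ⟨_, .ofNeutral h, .refl⟩⟩
  | arrow A B ihA ihB =>
    refine ⟨fun {Γ t} ht => ?_, fun {Γ t} ht Δ ρ a ha => ?_⟩
    · have h0 : NeutralForm (Tm.var (Γ := A :: Γ) ⟨0, by simp⟩) := .var _
      obtain ⟨n, hn, h⟩ := ihB.1 (ht (A :: Γ) (Ren.up Γ A) _ (ihA.2 h0))
      exact ⟨_, .lam hn, (BetaEta.eta t).trans (.congLam h)⟩
    · obtain ⟨n, hn, h⟩ := ihA.1 ha
      exact Reducible.of_betaEta (.congApp .refl h) (ihB.2 (.app (ht.rename ρ) hn))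

/-- The fundamental lemma: terms are reducible under reducible substitutions. -/
theorem Tm.reducible_subst {Γ Δ : List Ty} {A : Ty} (t : Tm Γ A) (σ : Sb Δ Γ)
    (hσ : ∀ i, Reducible _ (σ i)) : Reducible A (t.subst σ) := by
  induction t generalizing Δ with
  | var i => exact hσ i
  | app f a ihf iha =>
    have h := ihf σ hσ Δ (Ren.id Δ) _ (iha σ hσ)
    rwa [Tm.rename_id] at h
  | lam t ih =>
    intro Θ ρ a ha
    refine Reducible.of_betaEta (.beta _ a) ?_
    rw [Tm.rename_subst, Sb.lift_rename, Tm.subst_subst, Sb.single_comp_lift]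
    refine ih _ fun i => ?_
    refine Fin.cases ?_ (fun i => ?_) i
    · exact ha
    · exact (hσ i).rename ρ

/-- Normalization for the simply typed λ-calculus: every term is βη-equal to a term in
η-long β-normal form. -/
theorem stlc_normalization (Γ : List Ty) (A : Ty) (t : Tm Γ A) :
    ∃ n : Tm Γ A, NormalForm n ∧ BetaEta t n := by
  have h := t.reducible_subst (Sb.id Γ) fun i => (Reducible.reify_reflect _).2 (.var i)
  rw [Tm.subst_id] at h
  exact (Reducible.reify_reflect A).1 h
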